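/- Fix t > 0, L > 0, M₁ > 0 and M₂ > L with (4e)^{1/(M₂−L)} ≤ p^{s₀}, and assume κ(1) > 0 and κ(⌈Ls₀⌉) > 0. Then on the event 𝒜_n(t,L,M₁,M₂), any minimizer Q* of Q ↦ KL(Q ‖ Π(·|Y)) over the variational family 𝒬 satisfies KL(Q* ‖ Π(·|Y)) ≤ ζ_n, where ζ_n = s₀·log p·( L + (9/4)·M₁²·κ̄(Ls₀) + (λ·L^{1/2}/(‖X‖·√(log p)))·( 2M₁ + t·L^{1/2}/(4·κ(Ls₀)·‖X‖·√(log p)) + L^{1/2}/√(κ(1)·log p) ) ) + L·s₀·log(1/(4·κ(Ls₀))) + log(2e). -/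

import Mathlib

open MeasureTheory ProbabilityTheory
open scoped Classical ENNReal NNReal

/-- The logistic function `Ψ(t) = eᵗ/(1+eᵗ)`. -/
noncomputable def logistic (t : ℝ) : ℝ := Real.exp t / (1 + Real.exp t)

/-- Squared ℓ₂-norm of the `j`-th column of `X`. -/
noncomputable def colNormSq {n p : ℕ} (X : Fin n → Fin p → ℝ) (j : Fin p) : ℝ :=
  ∑ i, (X i j) ^ 2

/-- `‖X‖²`, the square of the largest column ℓ₂-norm of `X`. -/
noncomputable def XnormSq {n p : ℕ} (X : Fin n → Fin p → ℝ) : ℝ :=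
  ⨆ j, colNormSq X j

/-- `‖X‖`, the largest column ℓ₂-norm of `X`. -/
noncomputable def Xnorm {n p : ℕ} (X : Fin n → Fin p → ℝ) : ℝ :=
  Real.sqrt (XnormSq X)

/-- `‖X‖_∞ = max_{i,j} |X_{ij}|`. -/
noncomputable def XnormInf {n p : ℕ} (X : Fin n → Fin p → ℝ) : ℝ :=
  ⨆ i, ⨆ j, |X i j|

/-- The size of the support `S_θ = {j : θ_j ≠ 0}`. -/
noncomputable def suppCard {p : ℕ} (θ : Fin p → ℝ) : ℕ :=
  (Finset.univ.filter fun j => θ j ≠ 0).card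

/-- The diagonal weight `W_ii = Ψ(x_iᵀθ₀)(1−Ψ(x_iᵀθ₀))`. -/
noncomputable def Wdiag {n p : ℕ} (X : Fin n → Fin p → ℝ) (θ₀ : Fin p → ℝ) (i : Fin n) : ℝ :=
  logistic (∑ j, X i j * θ₀ j) * (1 - logistic (∑ j, X i j * θ₀ j))

/-- `κ̄(s) = sup{‖Xθ‖₂²/(‖X‖²‖θ‖₂²) : θ ≠ 0, |S_θ| ≤ s}`. -/
noncomputable def kappaBar {n p : ℕ} (X : Fin n → Fin p → ℝ) (s : ℝ) : ℝ :=
  sSup {r : ℝ | ∃ θ : Fin p → ℝ, θ ≠ 0 ∧ (suppCard θ : ℝ) ≤ s ∧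
    r = (∑ i, (∑ j, X i j * θ j) ^ 2) / (XnormSq X * ∑ j, (θ j) ^ 2)}

/-- `κ(s) = inf{‖W^{1/2}Xθ‖₂²/(‖X‖²‖θ‖₂²) : θ ≠ 0, |S_θ| ≤ s}`. -/
noncomputable def kappaLow {n p : ℕ} (X : Fin n → Fin p → ℝ) (θ₀ : Fin p → ℝ) (s : ℝ) : ℝ :=
  sInf {r : ℝ | ∃ θ : Fin p → ℝ, θ ≠ 0 ∧ (suppCard θ : ℝ) ≤ s ∧
    r = (∑ i, Wdiag X θ₀ i * (∑ j, X i j * θ j) ^ 2) / (XnormSq X * ∑ j, (θ j) ^ 2)}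

/-- The compatibility constant `κ`. -/
noncomputable def kappaComp {n p : ℕ} (X : Fin n → Fin p → ℝ) (θ₀ : Fin p → ℝ) : ℝ :=
  sInf {r : ℝ | ∃ θ : Fin p → ℝ, θ ≠ 0 ∧
    (∑ j ∈ Finset.univ.filter (fun j => θ₀ j = 0), |θ j|)
      ≤ 7 * ∑ j ∈ Finset.univ.filter (fun j => θ₀ j ≠ 0), |θ j| ∧
    r = (∑ i, Wdiag X θ₀ i * (∑ j, X i j * θ j) ^ 2) / (XnormSq X * ∑ j, (θ j) ^ 2)}

/-- The logistic log-likelihood `ℓ_{n,θ}(y)`. -/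
noncomputable def loglik {n p : ℕ} (X : Fin n → Fin p → ℝ) (y : Fin n → ℝ)
    (θ : Fin p → ℝ) : ℝ :=
  ∑ i, (y i * (∑ j, X i j * θ j) - Real.log (1 + Real.exp (∑ j, X i j * θ j)))

/-- The Laplace distribution `Lap(λ)` with density `(λ/2)e^{−λ|x|}`. -/
noncomputable def lapMeasure (lam : ℝ) : Measure ℝ :=
  volume.withDensity fun x => ENNReal.ofReal (lam / 2 * Real.exp (-lam * |x|))

/-- The model-selection prior: a dimension `s ~ π_p`, a uniform subset `S` of size `s`,
Laplace slabs on `S` and point mass at zero off `S`. -/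
noncomputable def priorMeasure (p : ℕ) (πp : ℕ → ℝ) (lam : ℝ) : Measure (Fin p → ℝ) :=
  ∑ s ∈ Finset.range (p + 1), ∑ S ∈ Finset.univ.powersetCard s,
    ENNReal.ofReal (πp s / (p.choose s : ℝ)) •
      Measure.pi fun j => if j ∈ S then lapMeasure lam else Measure.dirac 0

/-- The posterior distribution `Π(·|Y=y)`, with density proportional to `e^{ℓ_{n,θ}(y)}`
with respect to the prior. -/
noncomputable def posterior {n p : ℕ} (X : Fin n → Fin p → ℝ) (πp : ℕ → ℝ) (lam : ℝ)
    (y : Fin n → ℝ) : Measure (Fin p → ℝ) :=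
  (∫⁻ θ, ENNReal.ofReal (Real.exp (loglik X y θ)) ∂(priorMeasure p πp lam))⁻¹ •
    (priorMeasure p πp lam).withDensity fun θ => ENNReal.ofReal (Real.exp (loglik X y θ))

/-- The Kullback–Leibler divergence `KL(Q‖P) = ∫ log(dQ/dP) dQ`. -/
noncomputable def KLdiv {p : ℕ} (Q P : Measure (Fin p → ℝ)) : ℝ :=
  ∫ θ, Real.log ((Q.rnDeriv P θ).toReal) ∂Q

/-- The mean-field spike-and-slab variational family `𝒬`. -/
noncomputable def varFamily (p : ℕ) : Set (Measure (Fin p → ℝ)) :=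
  {Q | ∃ γ μ σ : Fin p → ℝ, (∀ j, γ j ∈ Set.Icc (0 : ℝ) 1) ∧ (∀ j, 0 < σ j) ∧
    Q = Measure.pi fun j =>
      ENNReal.ofReal (γ j) • gaussianReal (μ j) ⟨(σ j) ^ 2, sq_nonneg _⟩
        + ENNReal.ofReal (1 - γ j) • Measure.dirac 0}

/-- The event `𝒜_{n,1}(t) = {‖∇ℓ_{n,θ₀}(Y)‖_∞ ≤ t}`. -/
def eventA1 {n p : ℕ} (X : Fin n → Fin p → ℝ) (θ₀ : Fin p → ℝ) (t : ℝ) :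
    Set (Fin n → ℝ) :=
  {y | ∀ j, |∑ i, (y i - logistic (∑ j', X i j' * θ₀ j')) * X i j| ≤ t}

/-- The event `𝒜_{n,2}(L) = {Π(|S_θ| ≤ Ls₀ | Y) ≥ 3/4}`. -/
noncomputable def eventA2 {n p : ℕ} (X : Fin n → Fin p → ℝ) (θ₀ : Fin p → ℝ)
    (πp : ℕ → ℝ) (lam L : ℝ) : Set (Fin n → ℝ) :=
  {y | (3 / 4 : ℝ≥0∞) ≤
    posterior X πp lam y {θ | (suppCard θ : ℝ) ≤ L * (suppCard θ₀ : ℝ)}}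

/-- The event `𝒜_{n,3}(M₁,M₂) = {Π(‖θ−θ₀‖₂ > M₁√(s₀ log p)/‖X‖ | Y) ≤ e^{−M₂s₀ log p}}`. -/
noncomputable def eventA3 {n p : ℕ} (X : Fin n → Fin p → ℝ) (θ₀ : Fin p → ℝ)
    (πp : ℕ → ℝ) (lam M₁ M₂ : ℝ) : Set (Fin n → ℝ) :=
  {y | posterior X πp lam y
      {θ | M₁ * Real.sqrt ((suppCard θ₀ : ℝ) * Real.log p) / Xnorm X
        < Real.sqrt (∑ j, (θ j - θ₀ j) ^ 2)}
    ≤ ENNReal.ofReal (Real.exp (-M₂ * (suppCard θ₀ : ℝ) * Real.log p))}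

/-- The distribution of the data `Y`: independent coordinates `Y_i ~ Bernoulli(Ψ(x_iᵀθ₀))`. -/
noncomputable def dataMeasure {n p : ℕ} (X : Fin n → Fin p → ℝ) (θ₀ : Fin p → ℝ) :
    Measure (Fin n → ℝ) :=
  Measure.pi fun i =>
    ENNReal.ofReal (logistic (∑ j, X i j * θ₀ j)) • Measure.dirac (1 : ℝ)
      + ENNReal.ofReal (1 - logistic (∑ j, X i j * θ₀ j)) • Measure.dirac 0


lemma pi_wd {p : ℕ} (P : Fin p → Measure ℝ) [∀ j, IsProbabilityMeasure (P j)]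
    (f : Fin p → ℝ → ℝ≥0∞) (hf : ∀ j, Measurable (f j))
    [∀ j, SigmaFinite ((P j).withDensity (f j))] :
    Measure.pi (fun j => (P j).withDensity (f j))
      = (Measure.pi P).withDensity (fun θ => ∏ j, f j (θ j)) := by
  refine Measure.pi_eq fun s hs => ?_
  rw [withDensity_apply _ (MeasurableSet.univ_pi hs), ← lintegral_indicator (MeasurableSet.univ_pi hs)]
  have h1 : (Set.univ.pi s).indicator (fun θ : Fin p → ℝ => ∏ j, f j (θ j))
      = fun θ => ∏ j, (s j).indicator (f j) (θ j) := by
    ext θ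
    by_cases h : θ ∈ Set.univ.pi s
    · rw [Set.indicator_of_mem h]
      refine Finset.prod_congr rfl fun j _ => ?_
      rw [Set.indicator_of_mem (h j trivial)]
    · rw [Set.indicator_of_notMem h]
      simp only [Set.mem_pi, Set.mem_univ, true_implies, not_forall] at h
      obtain ⟨j, hj⟩ := h
      symm
      exact Finset.prod_eq_zero (Finset.mem_univ j) (Set.indicator_of_notMem hj _)
  rw [h1]
  have hm : ∀ j, Measurable ((s j).indicator (f j)) := fun j => (hf j).indicator (hs j)
  have hi := iIndepFun_pi (μ := P) (X := fun j => (s j).indicator (f j)) (fun j => (hm j).aemeasurable)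
  rw [lintegral_prod_eq_prod_lintegral_of_indepFun Finset.univ _ hi
    (fun j => (hm j).comp (measurable_pi_apply j))]
  refine Finset.prod_congr rfl fun j _ => ?_
  rw [withDensity_apply _ (hs j), ← lintegral_indicator (hs j)]
  exact (measurePreserving_eval P j).lintegral_comp (hm j)

lemma rn_le {α : Type*} [MeasurableSpace α] (Q m Pi : Measure α) [SigmaFinite Q] [IsFiniteMeasure Pi]
    (hm : m ≤ Pi) (f : α → ℝ≥0∞) (hQ : Q = m.withDensity f) (hac : Q ≪ Pi) :
    ∀ᵐ x ∂Q, Q.rnDeriv Pi x ≤ f x := by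
  apply hac.ae_le
  refine ae_le_of_forall_setLIntegral_le_of_sigmaFinite (Measure.measurable_rnDeriv _ _) fun s hs _ => ?_
  calc ∫⁻ x in s, Q.rnDeriv Pi x ∂Pi = Q s := Measure.setLIntegral_rnDeriv hac s
    _ = ∫⁻ x in s, f x ∂m := by rw [hQ, withDensity_apply _ hs]
    _ ≤ _ := lintegral_mono' (Measure.restrict_mono le_rfl hm) le_rfl

lemma logistic_quad (x d : ℝ) : Real.log (1 + Real.exp (x + d)) ≤
    Real.log (1 + Real.exp x) + Real.exp x / (1 + Real.exp x) * d + d ^ 2 / 2 := by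
  set F : ℝ → ℝ := fun d => Real.exp x / (1 + Real.exp x) * d + d ^ 2 / 2 - Real.log (1 + Real.exp (x + d)) with hF
  have hd : ∀ d, HasDerivAt F (Real.exp x / (1 + Real.exp x) + d - Real.exp (x + d) / (1 + Real.exp (x + d))) d := by
    intro d
    have h1 : HasDerivAt (fun d => Real.exp (x + d)) (Real.exp (x + d)) d := by
      simpa using ((hasDerivAt_id d).const_add x).exp
    have h2 := (h1.const_add 1).log (by positivity)
    have h3 := (((hasDerivAt_id d).const_mul (Real.exp x / (1 + Real.exp x))).add
      (((hasDerivAt_id d).pow 2).div_const 2)).sub h2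
    exact h3.congr_deriv (by simp)
  have lip : ∀ a b : ℝ, a ≤ b → Real.exp b / (1 + Real.exp b) - Real.exp a / (1 + Real.exp a) ≤ b - a := by
    intro a b hab
    have e1 : Real.exp b = Real.exp a * Real.exp (b - a) := by rw [← Real.exp_add]; ring_nf
    have e2 : 1 - Real.exp (-(b - a)) ≤ b - a := by linarith [Real.add_one_le_exp (-(b-a))]
    refine le_trans ?_ e2
    have : Real.exp (-(b-a)) = Real.exp a / Real.exp b := by rw [← Real.exp_sub]; ring_nf
    rw [this, sub_le_iff_le_add, ← sub_nonneg]
    have hle : Real.exp a ≤ Real.exp b := Real.exp_le_exp.2 hab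
    have ha := Real.exp_pos a
    have hb := Real.exp_pos b
    generalize Real.exp a = A at *
    generalize Real.exp b = B at *
    have : 1 - A / B + A / (1 + A) - B / (1 + B) = (B - A) * (1 + A + A * B) / (B * (1 + A) * (1 + B)) := by
      field_simp; ring
    rw [this]
    have : 0 ≤ B - A := by linarith
    positivity
  have key : F 0 ≤ F d := by
    rcases le_total 0 d with h | h
    · have : MonotoneOn F (Set.Ici 0) := by
        apply monotoneOn_of_deriv_nonneg (convex_Ici 0)
        · exact fun z _ => (hd z).continuousAt.continuousWithinAt
        · exact fun z _ => (hd z).differentiableAt.differentiableWithinAt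
        · intro z hz
          rw [interior_Ici] at hz
          rw [(hd z).deriv]
          have := lip x (x + z) (by linarith [hz.out])
          linarith
      exact this (by simp) h h
    · have : AntitoneOn F (Set.Iic 0) := by
        apply antitoneOn_of_deriv_nonpos (convex_Iic 0)
        · exact fun z _ => (hd z).continuousAt.continuousWithinAt
        · exact fun z _ => (hd z).differentiableAt.differentiableWithinAt
        · intro z hz
          rw [interior_Iic] at hz
          rw [(hd z).deriv]
          have := lip (x + z) x (by linarith [hz.out])
          linarith
      exact this h (by simp) h
  simp only [hF] at key
  simp at key
  linarith

lemma count_le (p : ℕ) (hp : 1 ≤ p) (K : ℝ) :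
    (((Finset.univ : Finset (Finset (Fin p))).filter (fun S => (S.card : ℝ) ≤ K)).card : ℝ)
      ≤ Real.exp 1 * (p : ℝ) ^ K := by
  have h0 : (((Finset.univ : Finset (Finset (Fin p))).filter (fun S => (S.card : ℝ) ≤ K)).card : ℝ)
     = ∑ s ∈ Finset.range (p + 1), ∑ S ∈ (Finset.univ : Finset (Fin p)).powersetCard s,
        if (S.card : ℝ) ≤ K then (1 : ℝ) else 0 := by
    have := Finset.sum_powerset (Finset.univ : Finset (Fin p)) (fun S => if (S.card : ℝ) ≤ K then (1 : ℝ) else 0)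
    rw [Finset.card_univ, Fintype.card_fin] at this
    rw [← this]
    simp
  rw [h0]
  have hp1 : (1 : ℝ) ≤ p := by exact_mod_cast hp
  calc _ ≤ ∑ s ∈ Finset.range (p + 1), (p : ℝ) ^ K * (1 ^ s / (s.factorial : ℝ)) := by
        refine Finset.sum_le_sum fun s hs => ?_
        have : ∑ S ∈ (Finset.univ : Finset (Fin p)).powersetCard s,
          (if (S.card : ℝ) ≤ K then (1 : ℝ) else 0) = (p.choose s : ℝ) * if (s : ℝ) ≤ K then (1 : ℝ) else 0 := by
          rw [Finset.sum_congr rfl (g := fun _ => if (s : ℝ) ≤ K then (1 : ℝ) else 0)]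
          · simp
          · intro S hS
            rw [(Finset.mem_powersetCard.1 hS).2]
        rw [this]
        split_ifs with h
        · have h1 := Nat.choose_le_pow_div (α := ℝ) s p
          have h2 : (p : ℝ) ^ s ≤ (p : ℝ) ^ K := by
            rw [← Real.rpow_natCast]
            exact Real.rpow_le_rpow_of_exponent_le hp1 h
          calc _ ≤ (p : ℝ) ^ s / (s.factorial : ℝ) := by simpa using h1
            _ ≤ (p : ℝ) ^ K / (s.factorial : ℝ) := by gcongr
            _ = _ := by simp [div_eq_mul_inv]
        · simp; positivity
    _ = (p : ℝ) ^ K * ∑ s ∈ Finset.range (p + 1), (1 ^ s / (s.factorial : ℝ)) := by rw [Finset.mul_sum]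
    _ ≤ (p : ℝ) ^ K * Real.exp 1 := by
        gcongr
        exact Real.sum_le_exp_of_nonneg zero_le_one _
    _ = _ := mul_comm _ _

noncomputable def laP {p : ℕ} (lam : ℝ) (S : Finset (Fin p)) (j : Fin p) : Measure ℝ :=
  if j ∈ S then lapMeasure lam else Measure.dirac 0

noncomputable def compS {n p : ℕ} (X : Fin n → Fin p → ℝ) (πp : ℕ → ℝ) (lam : ℝ)
    (y : Fin n → ℝ) (S : Finset (Fin p)) : Measure (Fin p → ℝ) :=
  (∫⁻ θ, ENNReal.ofReal (Real.exp (loglik X y θ)) ∂(priorMeasure p πp lam))⁻¹ •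
    (ENNReal.ofReal (πp S.card / (p.choose S.card : ℝ)) • Measure.pi (laP lam S)).withDensity
      fun θ => ENNReal.ofReal (Real.exp (loglik X y θ))

lemma posterior_eq {n p : ℕ} (X : Fin n → Fin p → ℝ) (πp : ℕ → ℝ) (lam : ℝ)
    (y : Fin n → ℝ) : posterior X πp lam y = ∑ S, compS X πp lam y S := by
  have h : priorMeasure p πp lam = Measure.sum fun S : Finset (Fin p) =>
      ENNReal.ofReal (πp S.card / (p.choose S.card : ℝ)) • Measure.pi (laP lam S) := by
    rw [Measure.sum_fintype]
    have := Finset.sum_powerset (Finset.univ : Finset (Fin p)) (fun S =>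
      ENNReal.ofReal (πp S.card / (p.choose S.card : ℝ)) • Measure.pi (laP lam S))
    rw [Finset.card_univ, Fintype.card_fin, Finset.powerset_univ] at this
    rw [this]
    unfold priorMeasure
    refine Finset.sum_congr rfl fun s _ => Finset.sum_congr rfl fun S hS => ?_
    rw [(Finset.mem_powersetCard.1 hS).2]
    rfl
  unfold _root_.posterior compS
  set Z := (∫⁻ θ, ENNReal.ofReal (Real.exp (loglik X y θ)) ∂(priorMeasure p πp lam))⁻¹
  rw [h, withDensity_sum, Measure.sum_fintype, Finset.smul_sum]

instance lap_sf (lam : ℝ) : SigmaFinite (lapMeasure lam) := by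
  unfold lapMeasure; infer_instance

instance laP_sf {p : ℕ} (lam : ℝ) (S : Finset (Fin p)) (j : Fin p) : SigmaFinite (laP lam S j) := by
  unfold laP; split_ifs <;> infer_instance

lemma laP_supp {p : ℕ} (lam : ℝ) (S : Finset (Fin p)) :
    ∀ᵐ θ ∂(Measure.pi (laP lam S)), ∀ j, θ j ≠ 0 ↔ j ∈ S := by
  rw [ae_all_iff]
  intro j
  have : ∀ᵐ x ∂(laP lam S j), x ≠ 0 ↔ j ∈ S := by
    unfold laP
    split_ifs with h
    · simp only [h, iff_true]
      have : ∀ᵐ x ∂(volume : Measure ℝ), x ≠ 0 := by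
        simp [ae_iff]
      exact (withDensity_absolutelyContinuous _ _).ae_le this
    · rw [ae_dirac_iff]
      · simp [h]
      · simp only [h, iff_false, not_not]; exact measurableSet_singleton 0
  exact (Measure.quasiMeasurePreserving_eval _ j).ae this

lemma compS_ac {n p : ℕ} (X : Fin n → Fin p → ℝ) (πp : ℕ → ℝ) (lam : ℝ)
    (y : Fin n → ℝ) (S : Finset (Fin p)) : compS X πp lam y S ≪ Measure.pi (laP lam S) := by
  unfold compS
  exact Measure.smul_absolutelyContinuous.trans ((withDensity_absolutelyContinuous _ _).trans
    Measure.smul_absolutelyContinuous)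

lemma compS_supp {n p : ℕ} (X : Fin n → Fin p → ℝ) (πp : ℕ → ℝ) (lam : ℝ)
    (y : Fin n → ℝ) (S : Finset (Fin p)) :
    ∀ᵐ θ ∂(compS X πp lam y S), ∀ j, θ j ≠ 0 ↔ j ∈ S :=
  (compS_ac X πp lam y S).ae_le (laP_supp lam S)

lemma select {n p : ℕ} (hp : 1 ≤ p) (X : Fin n → Fin p → ℝ) (πp : ℕ → ℝ) (lam : ℝ)
    (y : Fin n → ℝ) (K ε : ℝ) (hε : ε < 1 / 4) (B : Set (Fin p → ℝ))
    (hA : (3 / 4 : ℝ≥0∞) ≤ posterior X πp lam y {θ | (suppCard θ : ℝ) ≤ K})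
    (hB : posterior X πp lam y Bᶜ ≤ ENNReal.ofReal ε) :
    ∃ S : Finset (Fin p), (S.card : ℝ) ≤ K ∧
      ENNReal.ofReal (1 / (2 * Real.exp 1 * (p : ℝ) ^ K)) ≤ compS X πp lam y S B := by
  by_contra! hcon
  set A := {θ : Fin p → ℝ | (suppCard θ : ℝ) ≤ K} with hAdef
  have hpp : (0 : ℝ) < p := by exact_mod_cast hp
  have h1 : posterior X πp lam y (A ∩ B) ≤ ENNReal.ofReal (1 / 2) := by
    rw [posterior_eq, Measure.finsetSum_apply]
    calc ∑ S, compS X πp lam y S (A ∩ B)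
        ≤ ∑ S : Finset (Fin p), if (S.card : ℝ) ≤ K then
            ENNReal.ofReal (1 / (2 * Real.exp 1 * (p : ℝ) ^ K)) else 0 := by
          refine Finset.sum_le_sum fun S _ => ?_
          split_ifs with h
          · exact (measure_mono Set.inter_subset_right).trans (hcon S h).le
          · refine (measure_mono_null ?_ (compS_supp X πp lam y S)).le
            rintro θ ⟨hθ, -⟩ hs
            apply h
            have : suppCard θ = S.card := by
              unfold suppCard
              congr 1
              ext j
              simp [hs j]
            rw [← this]
            exact hθ
      _ = ENNReal.ofReal ((((Finset.univ : Finset (Finset (Fin p))).filter (fun S => (S.card : ℝ) ≤ K)).card : ℝ)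
            * (1 / (2 * Real.exp 1 * (p : ℝ) ^ K))) := by
          rw [← Finset.sum_filter, Finset.sum_const, ENNReal.ofReal_mul (by positivity)]
          simp
      _ ≤ ENNReal.ofReal (1 / 2) := by
          apply ENNReal.ofReal_le_ofReal
          have := count_le p hp K
          have hpos : 0 < (p : ℝ) ^ K := by positivity
          rw [mul_one_div, div_le_iff₀ (by positivity)]
          linarith
  have h2 : posterior X πp lam y A ≤ ENNReal.ofReal (1 / 2) + ENNReal.ofReal ε := by
    refine (measure_le_inter_add_sdiff _ A B).trans (add_le_add h1 ((measure_mono ?_).trans hB))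
    exact fun x hx => hx.2
  have h3 : (3 / 4 : ℝ≥0∞) = ENNReal.ofReal (3 / 4) := by
    rw [ENNReal.ofReal_div_of_pos (by norm_num)]; simp
  have h4 := hA.trans h2
  rw [h3] at h4
  have h5 : ENNReal.ofReal (1 / 2) + ENNReal.ofReal ε < ENNReal.ofReal (3 / 4) := by
    calc _ ≤ ENNReal.ofReal (1 / 2) + ENNReal.ofReal (max ε 0) := by
          gcongr; exact le_max_left _ _
      _ = ENNReal.ofReal (1 / 2 + max ε 0) := by
          rw [ENNReal.ofReal_add (by norm_num) (le_max_right _ _)]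
      _ < _ := by
          rw [ENNReal.ofReal_lt_ofReal_iff (by norm_num)]
          have : max ε 0 < 1 / 4 := max_lt hε (by norm_num)
          linarith
  exact absurd h4 (not_le.2 h5)

noncomputable def gaP {p : ℕ} (μ : Fin p → ℝ) (v : ℝ≥0) (S : Finset (Fin p)) (j : Fin p) :
    Measure ℝ :=
  if j ∈ S then gaussianReal (μ j) v else Measure.dirac 0

instance gaP_prob {p : ℕ} (μ : Fin p → ℝ) (v : ℝ≥0) (S : Finset (Fin p)) (j : Fin p) :
    IsProbabilityMeasure (gaP μ v S j) := by
  unfold gaP; split_ifs <;> infer_instance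

noncomputable def ratR {p : ℕ} (lam : ℝ) (μ : Fin p → ℝ) (v : ℝ≥0) (S : Finset (Fin p))
    (j : Fin p) (x : ℝ) : ℝ :=
  if j ∈ S then lam / 2 * Real.exp (-lam * |x|) / gaussianPDFReal (μ j) v x else 1

lemma ratR_pos {p : ℕ} {lam : ℝ} (hlam : 0 < lam) (μ : Fin p → ℝ) {v : ℝ≥0} (hv : v ≠ 0)
    (S : Finset (Fin p)) (j : Fin p) (x : ℝ) : 0 < ratR lam μ v S j x := by
  unfold ratR
  have := gaussianPDFReal_pos (μ j) v x hv
  split_ifs <;> positivity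

lemma ratR_meas {p : ℕ} (lam : ℝ) (μ : Fin p → ℝ) (v : ℝ≥0)
    (S : Finset (Fin p)) (j : Fin p) : Measurable (ratR lam μ v S j) := by
  unfold ratR
  have := measurable_gaussianPDFReal (μ j) v
  by_cases h : j ∈ S
  · simp only [h, if_true]; fun_prop
  · simp only [h, if_false]; fun_prop

lemma laP_eq {p : ℕ} {lam : ℝ} (hlam : 0 < lam) (μ : Fin p → ℝ) {v : ℝ≥0} (hv : v ≠ 0)
    (S : Finset (Fin p)) (j : Fin p) :
    laP lam S j = (gaP μ v S j).withDensity fun x => ENNReal.ofReal (ratR lam μ v S j x) := by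
  have hm := ratR_meas lam μ v S j
  unfold laP gaP
  by_cases h : j ∈ S
  · simp only [h, if_true]
    rw [gaussianReal_of_var_ne_zero _ hv, ← withDensity_mul _ (measurable_gaussianPDF _ _)
      (by fun_prop)]
    unfold lapMeasure
    congr 1
    ext x
    have hx := gaussianPDFReal_pos (μ j) v x hv
    simp only [Pi.mul_apply, gaussianPDF]
    rw [← ENNReal.ofReal_mul hx.le]
    congr 1
    simp only [ratR, h, if_true]
    field_simp
  · simp only [h, if_false, ratR]
    simp

lemma pi_laP_eq {p : ℕ} {lam : ℝ} (hlam : 0 < lam) (μ : Fin p → ℝ) {v : ℝ≥0} (hv : v ≠ 0)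
    (S : Finset (Fin p)) :
    Measure.pi (laP lam S) = (Measure.pi (gaP μ v S)).withDensity
      fun θ => ENNReal.ofReal (∏ j, ratR lam μ v S j (θ j)) := by
  have h1 : laP lam S = fun j => (gaP μ v S j).withDensity
      fun x => ENNReal.ofReal (ratR lam μ v S j x) := funext fun j => laP_eq hlam μ hv S j
  have : ∀ j, SigmaFinite ((gaP μ v S j).withDensity
      fun x => ENNReal.ofReal (ratR lam μ v S j x)) := fun j => inferInstance
  rw [h1, pi_wd _ _ (fun j => (ratR_meas lam μ v S j).ennreal_ofReal)]
  congr 1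
  ext θ
  rw [ENNReal.ofReal_prod_of_nonneg fun j _ => (ratR_pos hlam μ hv S j _).le]

lemma gaP_supp {p : ℕ} (μ : Fin p → ℝ) (v : ℝ≥0) (S : Finset (Fin p)) :
    ∀ᵐ θ ∂(Measure.pi (gaP μ v S)), ∀ j, j ∉ S → θ j = 0 := by
  rw [ae_all_iff]
  intro j
  have : ∀ᵐ x ∂(gaP μ v S j), j ∉ S → x = 0 := by
    unfold gaP
    split_ifs with h
    · simp [h]
    · rw [ae_dirac_iff]
      · simp
      · simp only [h, not_false_eq_true, true_implies]; exact measurableSet_singleton 0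
  exact (Measure.quasiMeasurePreserving_eval _ j).ae this

lemma gaP_mem {p : ℕ} (μ : Fin p → ℝ) (σ : ℝ) (hσ : 0 < σ) (S : Finset (Fin p)) :
    Measure.pi (gaP μ ⟨σ ^ 2, sq_nonneg _⟩ S) ∈ varFamily p := by
  refine ⟨fun j => if j ∈ S then 1 else 0, μ, fun _ => σ, ?_, fun _ => hσ, ?_⟩
  · intro j; dsimp only; split_ifs <;> simp
  · congr 1
    ext1 j
    unfold gaP
    by_cases h : j ∈ S
    · simp [h]
    · simp [h]

lemma loglik_cont {n p : ℕ} (X : Fin n → Fin p → ℝ) (y : Fin n → ℝ) :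
    Continuous (loglik X y) := by
  unfold loglik
  refine continuous_finsetSum _ fun i _ => Continuous.sub (by fun_prop) ?_
  exact Continuous.log (by fun_prop) fun θ => by positivity

lemma loglik_lower {n p : ℕ} (X : Fin n → Fin p → ℝ) (y : Fin n → ℝ) (μ θ : Fin p → ℝ) :
    loglik X y μ + ∑ j, (∑ i, (y i - logistic (∑ k, X i k * μ k)) * X i j) * (θ j - μ j)
      - (∑ i, (∑ j, X i j * (θ j - μ j)) ^ 2) / 2 ≤ loglik X y θ := by
  have e : ∑ j, (∑ i, (y i - logistic (∑ k, X i k * μ k)) * X i j) * (θ j - μ j)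
      = ∑ i, (y i - logistic (∑ k, X i k * μ k)) * ∑ j, X i j * (θ j - μ j) := by
    simp_rw [Finset.sum_mul, Finset.mul_sum]
    rw [Finset.sum_comm]
    simp_rw [mul_assoc]
  rw [e, Finset.sum_div]
  unfold loglik
  rw [← Finset.sum_add_distrib, ← Finset.sum_sub_distrib]
  refine Finset.sum_le_sum fun i _ => ?_
  have h1 : ∑ j, X i j * θ j = ∑ j, X i j * μ j + ∑ j, X i j * (θ j - μ j) := by
    rw [← Finset.sum_add_distrib]
    exact Finset.sum_congr rfl fun j _ => by ring
  rw [h1]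
  have := logistic_quad (∑ j, X i j * μ j) (∑ j, X i j * (θ j - μ j))
  unfold logistic
  linarith

lemma gauss_term (m b lam σ : ℝ) (hσ : 0 < σ) (hlam : 0 < lam) :
    Integrable (fun x => lam * |x - m| - b * (x - m)) (gaussianReal m ⟨σ ^ 2, sq_nonneg _⟩) ∧
    ∫ x, (lam * |x - m| - b * (x - m)) ∂(gaussianReal m ⟨σ ^ 2, sq_nonneg _⟩) ≤ lam * σ := by
  set v : ℝ≥0 := ⟨σ ^ 2, sq_nonneg _⟩ with hv
  have hid : MemLp (fun x : ℝ => x) 2 (gaussianReal m v) := memLp_id_gaussianReal 2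
  have h2 : MemLp (fun x : ℝ => x - m) 2 (gaussianReal m v) := hid.sub (memLp_const m)
  have h1 : Integrable (fun x : ℝ => x - m) (gaussianReal m v) := h2.integrable (by norm_num)
  have hsq : Integrable (fun x : ℝ => (x - m) ^ 2) (gaussianReal m v) := h2.integrable_sq
  have hmean : ∫ x, (x - m) ∂(gaussianReal m v) = 0 := by
    rw [integral_sub (hid.integrable (by norm_num)) (integrable_const m), integral_id_gaussianReal]
    simp
  have hvar : ∫ x, (x - m) ^ 2 ∂(gaussianReal m v) = σ ^ 2 := by
    have := variance_fun_id_gaussianReal (μ := m) (v := v)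
    rw [variance_eq_integral (by fun_prop)] at this
    simp only [integral_id_gaussianReal] at this
    rw [this]; rfl
  refine ⟨(h1.abs.const_mul lam).sub (h1.const_mul b), ?_⟩
  rw [integral_sub (h1.abs.const_mul lam) (h1.const_mul b), integral_const_mul, integral_const_mul,
    hmean]
  have : ∫ x, |x - m| ∂(gaussianReal m v) ≤ ∫ x, ((x - m) ^ 2 / (2 * σ) + σ / 2) ∂(gaussianReal m v) := by
    refine integral_mono h1.abs ((hsq.div_const _).add (integrable_const _)) fun x => ?_
    dsimp only
    rw [← sq_abs]
    have : |x - m| ^ 2 / (2 * σ) + σ / 2 - |x - m| = (|x - m| - σ) ^ 2 / (2 * σ) := by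
      field_simp; ring
    have h : 0 ≤ (|x - m| - σ) ^ 2 / (2 * σ) := by positivity
    linarith
  rw [integral_add (hsq.div_const _) (integrable_const _), integral_div, hvar] at this
  have e : σ ^ 2 / (2 * σ) + σ / 2 = σ := by field_simp; ring
  simp at this
  rw [e] at this
  have := mul_le_mul_of_nonneg_left this hlam.le
  linarith

lemma log_ratR {p : ℕ} {lam : ℝ} (hlam : 0 < lam) (μ : Fin p → ℝ) {v : ℝ≥0} (hv : v ≠ 0)
    (S : Finset (Fin p)) (θ : Fin p → ℝ) :
    Real.log (∏ j, ratR lam μ v S j (θ j)) = (S.card : ℝ) * (Real.log (lam / 2) + Real.log (√(2 * Real.pi * v)))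
      - lam * ∑ j ∈ S, |θ j| + (∑ j ∈ S, (θ j - μ j) ^ 2) / (2 * v) := by
  have hv' : (0 : ℝ) < v := by exact_mod_cast pos_iff_ne_zero.2 hv
  rw [Real.log_prod (fun j _ => (ratR_pos hlam μ hv S j _).ne')]
  have : ∀ j, Real.log (ratR lam μ v S j (θ j)) = if j ∈ S then
      (Real.log (lam / 2) + Real.log (√(2 * Real.pi * v))) - lam * |θ j| + (θ j - μ j) ^ 2 / (2 * v) else 0 := by
    intro j
    unfold ratR
    split_ifs with h
    · have hs : 0 < √(2 * Real.pi * v) := by positivity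
      rw [gaussianPDFReal, Real.log_div (by positivity) (by positivity), Real.log_mul (by positivity) (by positivity),
        Real.log_mul (by positivity) (by positivity), Real.log_exp, Real.log_exp, Real.log_inv]
      ring
    · simp
  simp_rw [this]
  rw [Finset.sum_ite_mem, Finset.univ_inter, Finset.sum_add_distrib, Finset.sum_sub_distrib,
    Finset.sum_const, ← Finset.mul_sum, ← Finset.sum_div]
  rw [nsmul_eq_mul]

lemma l1_le {p : ℕ} (S : Finset (Fin p)) (r : ℝ) (hr : 0 ≤ r) (d : Fin p → ℝ)
    (h : ∑ j, d j ^ 2 ≤ 4 * r ^ 2) : ∑ j ∈ S, |d j| ≤ 2 * r * √(S.card) := by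
  have h1 : (∑ j ∈ S, |d j|) ^ 2 ≤ (S.card : ℝ) * ∑ j ∈ S, |d j| ^ 2 := sq_sum_le_card_mul_sum_sq
  have h2 : ∑ j ∈ S, |d j| ^ 2 ≤ 4 * r ^ 2 := by
    simp_rw [sq_abs]
    exact (Finset.sum_le_univ_sum_of_nonneg fun j => sq_nonneg _).trans h
  refine (abs_le_of_sq_le_sq' ?_ (by positivity)).2
  rw [mul_pow, Real.sq_sqrt (by positivity)]
  nlinarith [Nat.cast_nonneg (α := ℝ) S.card]

lemma lemB {n p : ℕ} (X : Fin n → Fin p → ℝ) (θ₀ : Fin p → ℝ) (πp : ℕ → ℝ) (lam : ℝ)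
    (hlam : 0 < lam) (y : Fin n → ℝ) (S : Finset (Fin p)) (r V c : ℝ) (hr : 0 ≤ r) (hV : 0 < V)
    (hc : 0 < c) (hc1 : c ≤ 1)
    (hX : ∀ θ : Fin p → ℝ, (∀ j, j ∉ S → θ j = 0) →
      ∑ i, (∑ j, X i j * θ j) ^ 2 ≤ V * ∑ j, θ j ^ 2)
    (hfin : IsFiniteMeasure (posterior X πp lam y))
    (hZ0 : ∫⁻ θ, ENNReal.ofReal (Real.exp (loglik X y θ)) ∂(priorMeasure p πp lam) ≠ 0)
    (hZt : ∫⁻ θ, ENNReal.ofReal (Real.exp (loglik X y θ)) ∂(priorMeasure p πp lam) ≠ ∞)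
    (hle : compS X πp lam y S ≤ posterior X πp lam y)
    (hcB : ENNReal.ofReal c ≤ compS X πp lam y S {θ | √(∑ j, (θ j - θ₀ j) ^ 2) ≤ r}) :
    ∃ Q ∈ varFamily p, KLdiv Q (posterior X πp lam y) ≤
      -Real.log c + 2 * lam * r * √(S.card) + 2 * V * r ^ 2 + lam * S.card / √V := by
  have hnn : 0 ≤ 2 * lam * r * √(S.card) + 2 * V * r ^ 2 + lam * S.card / √V := by
    positivity
  set B := {θ : Fin p → ℝ | √(∑ j, (θ j - θ₀ j) ^ 2) ≤ r} with hB
  have hBm : MeasurableSet B := measurableSet_le (by fun_prop) (by fun_prop)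
  have hBsq : ∀ θ ∈ B, ∑ j, (θ j - θ₀ j) ^ 2 ≤ r ^ 2 := by
    intro θ hθ
    exact (Real.sqrt_le_left hr).1 hθ
  have hcpos : 0 < compS X πp lam y S B := (ENNReal.ofReal_pos.2 hc).trans_le hcB
  -- the compact set
  set Kc := {θ : Fin p → ℝ | (∀ j, j ∉ S → θ j = 0) ∧ θ ∈ B} with hKc
  have hne : Kc.Nonempty := by
    by_contra hcon
    rw [Set.not_nonempty_iff_eq_empty] at hcon
    refine hcpos.ne' (measure_mono_null ?_ (compS_supp X πp lam y S))
    intro θ hθ hs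
    have : θ ∈ Kc := ⟨fun j hj => by
      by_contra h
      exact hj ((hs j).1 h), hθ⟩
    rw [hcon] at this
    exact this
  have hcl : IsClosed Kc := by
    apply IsClosed.inter
    · have e : {θ : Fin p → ℝ | ∀ j, j ∉ S → θ j = 0} = ⋂ j, ⋂ (_ : j ∉ S), {θ | θ j = 0} := by
        ext; simp
      change IsClosed {θ : Fin p → ℝ | ∀ j, j ∉ S → θ j = 0}
      rw [e]
      refine isClosed_iInter fun j => isClosed_iInter fun _ => ?_
      exact isClosed_eq (by fun_prop) (by fun_prop)
    · exact isClosed_le (by fun_prop) (by fun_prop)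
  have hcomp : IsCompact Kc := by
    apply (isCompact_univ_pi fun j : Fin p => isCompact_Icc (a := θ₀ j - r) (b := θ₀ j + r)).of_isClosed_subset hcl
    intro θ hθ j _
    have h1 : (θ j - θ₀ j) ^ 2 ≤ r ^ 2 :=
      (Finset.single_le_sum (f := fun j => (θ j - θ₀ j) ^ 2) (fun j _ => sq_nonneg _) (Finset.mem_univ j)).trans (hBsq θ hθ.2)
    have := abs_le_of_sq_le_sq' h1 hr
    exact ⟨by linarith, by linarith⟩
  obtain ⟨μ, hμK, hμ⟩ := hcomp.exists_isMaxOn hne (loglik_cont X y).continuousOn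
  -- constants
  set σ := 1 / √V with hσ
  have hσp : 0 < σ := by positivity
  set v : ℝ≥0 := ⟨σ ^ 2, sq_nonneg _⟩ with hvdef
  have hvr : (v : ℝ) = 1 / V := by
    change σ ^ 2 = 1 / V
    rw [hσ, div_pow, Real.sq_sqrt hV.le]; simp
  have hv : v ≠ 0 := by
    intro h
    have : (v : ℝ) = 0 := by rw [h]; rfl
    rw [hvr] at this
    exact (one_div_pos.2 hV).ne' this
  set Q := Measure.pi (gaP μ v S) with hQ
  set Z := ∫⁻ θ, ENNReal.ofReal (Real.exp (loglik X y θ)) ∂(priorMeasure p πp lam) with hZ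
  set w := πp S.card / (p.choose S.card : ℝ) with hw
  have hw0 : 0 < w := by
    by_contra h
    have : compS X πp lam y S = 0 := by
      unfold compS
      rw [← hw, ENNReal.ofReal_of_nonpos (not_lt.1 h)]
      simp
    rw [this] at hcpos
    simp at hcpos
  have hz : 0 < Z.toReal := ENNReal.toReal_pos hZ0 hZt
  set D : (Fin p → ℝ) → ℝ := fun θ => (Z.toReal)⁻¹ * w * (∏ j, ratR lam μ v S j (θ j)) * Real.exp (loglik X y θ) with hD
  have hprodpos : ∀ θ : Fin p → ℝ, 0 < ∏ j, ratR lam μ v S j (θ j) := fun θ =>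
    Finset.prod_pos fun j _ => ratR_pos hlam μ hv S j _
  have hDpos : ∀ θ, 0 < D θ := fun θ => by have := hprodpos θ; positivity
  have hprodm : Measurable fun θ : Fin p → ℝ => ∏ j, ratR lam μ v S j (θ j) :=
    Finset.measurable_prod _ fun j _ => (ratR_meas lam μ v S j).comp (measurable_pi_apply j)
  have hlm : Measurable (loglik X y) := (loglik_cont X y).measurable
  have hDm : Measurable D := by
    exact (hprodm.const_mul _).mul hlm.exp
  have hcompQ : compS X πp lam y S = Q.withDensity fun θ => ENNReal.ofReal (D θ) := by
    unfold compS
    rw [← hZ, ← hw, pi_laP_eq hlam μ hv S, ← hQ, ← withDensity_smul _ hprodm.ennreal_ofReal,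
      ← withDensity_mul _ (by fun_prop) hlm.exp.ennreal_ofReal, ← withDensity_smul _ (by fun_prop)]
    congr 1
    ext θ
    simp only [Pi.smul_apply, Pi.mul_apply, smul_eq_mul, hD]
    have := hprodpos θ
    rw [ENNReal.ofReal_mul (by positivity), ENNReal.ofReal_mul (by positivity), ENNReal.ofReal_mul (by positivity),
      ENNReal.ofReal_inv_of_pos hz, ENNReal.ofReal_toReal hZt]
    ring
  have hQcomp : Q = (compS X πp lam y S).withDensity fun θ => ENNReal.ofReal (1 / D θ) := by
    rw [hcompQ, ← withDensity_mul _ hDm.ennreal_ofReal (by fun_prop)]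
    have : ((fun θ => ENNReal.ofReal (D θ)) * fun θ => ENNReal.ofReal (1 / D θ)) = 1 := by
      ext θ
      simp only [Pi.mul_apply, Pi.one_apply]
      rw [← ENNReal.ofReal_mul (hDpos θ).le, mul_one_div_cancel (hDpos θ).ne', ENNReal.ofReal_one]
    rw [this, withDensity_one]
  have hQac : Q ≪ posterior X πp lam y := by
    have h1 : Q ≪ compS X πp lam y S := by
      conv_lhs => rw [hQcomp]
      exact withDensity_absolutelyContinuous _ _
    exact h1.trans (Measure.absolutelyContinuous_of_le hle)
  have hrn := rn_le Q _ _ hle _ hQcomp hQac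
  have hrpos := Measure.rnDeriv_pos hQac
  -- log density
  set c0 := Real.log ((Z.toReal)⁻¹ * w) + (S.card : ℝ) * (Real.log (lam / 2) + Real.log (√(2 * Real.pi * v))) with hc0
  have hlogD : ∀ θ, Real.log (D θ) = c0 - lam * ∑ j ∈ S, |θ j| + V / 2 * ∑ j ∈ S, (θ j - μ j) ^ 2
      + loglik X y θ := by
    intro θ
    simp only [hD]
    rw [Real.log_mul (by have := hprodpos θ; positivity) (by positivity),
      Real.log_mul (by positivity) (hprodpos θ).ne', Real.log_exp, log_ratR hlam μ hv S θ, hvr, hc0, hvr]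
    field_simp
    ring
  have hsupQ := gaP_supp μ v S
  set T := c0 - lam * ∑ j ∈ S, |μ j| + 2 * lam * r * √(S.card) + 2 * V * r ^ 2 + loglik X y μ with hT
  have hup : ∀ θ ∈ Kc, D θ ≤ Real.exp T := by
    intro θ hθ
    rw [← Real.log_le_iff_le_exp (hDpos θ), hlogD]
    have hsq : ∑ j, (θ j - μ j) ^ 2 ≤ 4 * r ^ 2 := by
      have h1 := hBsq θ hθ.2
      have h2 := hBsq μ hμK.2
      have h3 : ∑ j, (θ j - μ j) ^ 2 ≤ 2 * ∑ j, (θ j - θ₀ j) ^ 2 + 2 * ∑ j, (μ j - θ₀ j) ^ 2 := by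
        rw [Finset.mul_sum, Finset.mul_sum, ← Finset.sum_add_distrib]
        refine Finset.sum_le_sum fun j _ => ?_
        nlinarith [sq_nonneg (θ j - θ₀ j + (μ j - θ₀ j))]
      linarith
    have hl1 := l1_le S r hr _ hsq
    have hsqS : ∑ j ∈ S, (θ j - μ j) ^ 2 ≤ 4 * r ^ 2 :=
      (Finset.sum_le_univ_sum_of_nonneg fun j => sq_nonneg _).trans hsq
    have hll : loglik X y θ ≤ loglik X y μ := hμ hθ
    have htri : ∑ j ∈ S, |μ j| ≤ ∑ j ∈ S, |θ j| + ∑ j ∈ S, |θ j - μ j| := by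
      rw [← Finset.sum_add_distrib]
      refine Finset.sum_le_sum fun j _ => ?_
      have := abs_sub_abs_le_abs_sub (μ j) (θ j)
      rw [abs_sub_comm] at this
      linarith
    have hA : lam * ∑ j ∈ S, |μ j| ≤ lam * ∑ j ∈ S, |θ j| + 2 * lam * r * √(S.card) := by
      nlinarith
    have hB' : V / 2 * ∑ j ∈ S, (θ j - μ j) ^ 2 ≤ 2 * V * r ^ 2 := by nlinarith
    rw [hT]
    linarith
  have hlogc : Real.log c ≤ T := by
    rw [Real.log_le_iff_le_exp hc]
    have : ENNReal.ofReal c ≤ ENNReal.ofReal (Real.exp T) := by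
      refine hcB.trans ?_
      rw [hcompQ, withDensity_apply _ hBm]
      calc ∫⁻ θ in B, ENNReal.ofReal (D θ) ∂Q ≤ ∫⁻ θ in B, ENNReal.ofReal (Real.exp T) ∂Q := by
            refine setLIntegral_mono_ae (by fun_prop) ?_
            filter_upwards [hsupQ] with θ hθ hθB
            exact ENNReal.ofReal_le_ofReal (hup θ ⟨hθ, hθB⟩)
        _ = ENNReal.ofReal (Real.exp T) * Q B := by rw [setLIntegral_const]
        _ ≤ ENNReal.ofReal (Real.exp T) * 1 := by gcongr; exact prob_le_one
        _ = _ := mul_one _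
    exact (ENNReal.ofReal_le_ofReal_iff (Real.exp_pos T).le).1 this
  set b : Fin p → ℝ := fun j => ∑ i, (y i - logistic (∑ k, X i k * μ k)) * X i j with hb
  set C1 := -c0 + lam * ∑ j ∈ S, |μ j| - loglik X y μ with hC1
  set h : (Fin p → ℝ) → ℝ := fun θ => C1 + ∑ j ∈ S, (lam * |θ j - μ j| - b j * (θ j - μ j)) with hh
  have hae : ∀ᵐ θ ∂Q, Real.log ((Q.rnDeriv (posterior X πp lam y) θ).toReal) ≤ h θ := by
    filter_upwards [hrn, hrpos, hsupQ] with θ h1 h2 h3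
    have h4 : (Q.rnDeriv (posterior X πp lam y) θ).toReal ≤ 1 / D θ := by
      exact ENNReal.toReal_le_of_le_ofReal (one_div_pos.2 (hDpos θ)).le h1
    have h5 : 0 < (Q.rnDeriv (posterior X πp lam y) θ).toReal :=
      ENNReal.toReal_pos h2.ne' (ne_top_of_le_ne_top ENNReal.ofReal_ne_top h1)
    have h6 := Real.log_le_log h5 h4
    rw [one_div, Real.log_inv, hlogD] at h6
    have hd0 : ∀ j, j ∉ S → θ j - μ j = 0 := fun j hj => by rw [h3 j hj, hμK.1 j hj]; simp
    have h7 := loglik_lower X y μ θ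
    have h8 := hX (fun j => θ j - μ j) hd0
    have e1 : ∑ j, (θ j - μ j) ^ 2 = ∑ j ∈ S, (θ j - μ j) ^ 2 := by
      symm
      exact Finset.sum_subset (Finset.subset_univ S) fun j _ hj => by rw [hd0 j hj]; simp
    have e2 : ∑ j, b j * (θ j - μ j) = ∑ j ∈ S, b j * (θ j - μ j) := by
      symm
      exact Finset.sum_subset (Finset.subset_univ S) fun j _ hj => by rw [hd0 j hj]; simp
    rw [e1] at h8
    change loglik X y μ + ∑ j, b j * (θ j - μ j) - _ ≤ _ at h7
    rw [e2] at h7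
    have htri : ∑ j ∈ S, |θ j| ≤ ∑ j ∈ S, |μ j| + ∑ j ∈ S, |θ j - μ j| := by
      rw [← Finset.sum_add_distrib]
      refine Finset.sum_le_sum fun j _ => ?_
      have := abs_sub_abs_le_abs_sub (θ j) (μ j)
      linarith
    have htri' := mul_le_mul_of_nonneg_left htri hlam.le
    simp only [hh, hC1, Finset.sum_sub_distrib, ← Finset.mul_sum]
    linarith
  have hterm : ∀ j ∈ S, Integrable (fun θ : Fin p → ℝ => lam * |θ j - μ j| - b j * (θ j - μ j)) Q ∧
      ∫ θ, (lam * |θ j - μ j| - b j * (θ j - μ j)) ∂Q ≤ lam * σ := by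
    intro j hj
    have hg := gauss_term (μ j) (b j) lam σ hσp hlam
    have hmp := measurePreserving_eval (gaP μ v S) j
    have hgj : gaP μ v S j = gaussianReal (μ j) v := by unfold gaP; simp [hj]
    rw [hgj] at hmp
    refine ⟨hmp.integrable_comp_of_integrable hg.1, ?_⟩
    have := hg.2
    rw [← hvdef, ← hmp.map_eq, integral_map hmp.measurable.aemeasurable (by fun_prop)] at this
    exact this
  have hhi : Integrable h Q := (integrable_const _).add (integrable_finsetSum _ fun j hj => (hterm j hj).1)
  have hhint : ∫ θ, h θ ∂Q ≤ C1 + lam * S.card / √V := by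
    simp only [hh]
    rw [integral_add (integrable_const _) (integrable_finsetSum _ fun j hj => (hterm j hj).1),
      integral_finsetSum _ fun j hj => (hterm j hj).1]
    have := Finset.sum_le_sum fun j hj => (hterm j hj).2
    rw [Finset.sum_const, nsmul_eq_mul, hσ] at this
    simp only [integral_const, probReal_univ, one_smul]
    have e : lam * S.card / √V = S.card * (lam * (1 / √V)) := by ring
    rw [e]
    linarith
  refine ⟨Q, gaP_mem μ σ hσp S, ?_⟩
  have hlogc0 : Real.log c ≤ 0 := Real.log_nonpos hc.le hc1
  unfold KLdiv
  by_cases hint : Integrable (fun θ => Real.log ((Q.rnDeriv (posterior X πp lam y) θ).toReal)) Q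
  · have := (integral_mono_ae hint hhi hae).trans hhint
    refine this.trans ?_
    linarith
  · rw [integral_undef hint]
    linarith

lemma final_arith (s p L M₁ lam t N N2 kb kL k1 k r : ℝ) (hs : 0 < s) (hp : 1 < p) (hL : 0 < L)
    (hM₁ : 0 < M₁) (hlam : 0 < lam) (ht : 0 < t) (hN : 0 < N) (hN2 : N ^ 2 = N2) (hkb : 1 ≤ kb)
    (hkL : 0 < kL) (hkL' : kL ≤ 1 / 4) (hk1 : 0 < k1) (hk1' : k1 ≤ 1 / 4) (hk : k ≤ L * s)
    (hk0 : 0 ≤ k) (hr : r = M₁ * √(s * Real.log p) / N) :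
    -Real.log (1 / (2 * Real.exp 1 * p ^ (L * s))) + 2 * lam * r * √k + 2 * (kb * N2) * r ^ 2
      + lam * k / √(kb * N2)
    ≤ s * Real.log p * (L + (9 / 4) * M₁ ^ 2 * kb + (lam * √L / (N * √(Real.log p))) *
        (2 * M₁ + t * √L / (4 * kL * N * √(Real.log p)) + √L / √(k1 * Real.log p)))
      + L * s * Real.log (1 / (4 * kL)) + Real.log (2 * Real.exp 1) := by
  have hl : 0 < Real.log p := Real.log_pos hp
  have hp0 : 0 < p := by linarith
  have e1 : -Real.log (1 / (2 * Real.exp 1 * p ^ (L * s))) = Real.log (2 * Real.exp 1) + L * s * Real.log p := by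
    rw [one_div, Real.log_inv, neg_neg, Real.log_mul (by positivity) (by positivity), Real.log_rpow hp0]
  have h5 : 0 ≤ L * s * Real.log (1 / (4 * kL)) := by
    have : 0 ≤ Real.log (1 / (4 * kL)) := by
      apply Real.log_nonneg
      rw [le_div_iff₀ (by positivity)]
      linarith
    positivity
  rw [e1]
  generalize Real.log p = l at *
  have hsl : √(s * l) = √s * √l := Real.sqrt_mul hs.le _
  have qs : √s ^ 2 = s := Real.sq_sqrt hs.le
  have ql : √l ^ 2 = l := Real.sq_sqrt hl.le
  have qL : √L ^ 2 = L := Real.sq_sqrt hL.le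
  have ps : 0 < √s := Real.sqrt_pos.2 hs
  have pl : 0 < √l := Real.sqrt_pos.2 hl
  have pL : 0 < √L := Real.sqrt_pos.2 hL
  have pk1 : 0 < √k1 := Real.sqrt_pos.2 hk1
  have hr0 : 0 ≤ r := by rw [hr]; positivity
  have h2 : 2 * lam * r * √k ≤ s * l * ((lam * √L / (N * √l)) * (2 * M₁)) := by
    have : √k ≤ √L * √s := by
      rw [← Real.sqrt_mul hL.le]; exact Real.sqrt_le_sqrt hk
    calc 2 * lam * r * √k ≤ 2 * lam * r * (√L * √s) := by gcongr
      _ = s * l * ((lam * √L / (N * √l)) * (2 * M₁)) := by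
        rw [hr, hsl]
        generalize √s = a at *
        generalize √l = b at *
        rw [← qs, ← ql]
        field_simp
  have h3 : 2 * (kb * N2) * r ^ 2 ≤ s * l * ((9 / 4) * M₁ ^ 2 * kb) := by
    have : 2 * (kb * N2) * r ^ 2 = s * l * (2 * M₁ ^ 2 * kb) := by
      rw [hr, ← hN2, div_pow, mul_pow, Real.sq_sqrt (by positivity)]
      field_simp
    rw [this]
    gcongr
    norm_num
  have h4 : lam * k / √(kb * N2) ≤ s * l * ((lam * √L / (N * √l)) * (√L / √(k1 * l))) := by
    have e : s * l * ((lam * √L / (N * √l)) * (√L / √(k1 * l))) = lam * (L * s) / (N * √k1) := by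
      rw [Real.sqrt_mul hk1.le]
      generalize √L = a at *
      generalize √l = b at *
      rw [← qL, ← ql]
      field_simp
    rw [e]
    have : N * √k1 ≤ √(kb * N2) := by
      rw [← hN2]
      apply Real.le_sqrt_of_sq_le
      rw [mul_pow, Real.sq_sqrt hk1.le]
      nlinarith [sq_pos_of_pos hN]
    gcongr
  have h6 : 0 ≤ s * l * ((lam * √L / (N * √l)) * (t * √L / (4 * kL * N * √l))) := by positivity
  nlinarith

lemma colNormSq_le {n p : ℕ} (X : Fin n → Fin p → ℝ) (j : Fin p) : colNormSq X j ≤ XnormSq X :=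
  le_ciSup (f := fun j => colNormSq X j) (Set.finite_range _).bddAbove j

lemma XnormSq_nonneg {n p : ℕ} [NeZero p] (X : Fin n → Fin p → ℝ) : 0 ≤ XnormSq X :=
  le_trans (Finset.sum_nonneg fun _ _ => sq_nonneg _) (colNormSq_le X 0)

lemma Wdiag_bds {n p : ℕ} (X : Fin n → Fin p → ℝ) (θ₀ : Fin p → ℝ) (i : Fin n) :
    0 ≤ Wdiag X θ₀ i ∧ Wdiag X θ₀ i ≤ 1 / 4 := by
  unfold Wdiag
  set q := logistic (∑ j, X i j * θ₀ j) with hq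
  have h0 : 0 ≤ q := by rw [hq]; unfold logistic; positivity
  have h1 : q ≤ 1 := by
    rw [hq]; unfold logistic
    rw [div_le_one (by positivity)]; linarith
  exact ⟨mul_nonneg h0 (by linarith), by nlinarith [sq_nonneg (q - 1 / 2)]⟩

lemma e_sum {n p : ℕ} (X : Fin n → Fin p → ℝ) (j : Fin p) (i : Fin n) :
    ∑ k, X i k * (Pi.single j 1 : Fin p → ℝ) k = X i j := by
  simp [Pi.single_apply]

lemma e_sq {p : ℕ} (j : Fin p) : ∑ k, ((Pi.single j 1 : Fin p → ℝ) k) ^ 2 = 1 := by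
  simp [Pi.single_apply]

lemma e_card {p : ℕ} (j : Fin p) : suppCard (Pi.single j 1 : Fin p → ℝ) = 1 := by
  unfold suppCard
  rw [Finset.card_eq_one]
  refine ⟨j, ?_⟩
  ext k
  simp [Pi.single_apply]

lemma e_ne {p : ℕ} (j : Fin p) : (Pi.single j 1 : Fin p → ℝ) ≠ 0 := by
  intro h
  have := congrFun h j
  simp at this

lemma kappaLow_le_e {n p : ℕ} [NeZero p] (X : Fin n → Fin p → ℝ) (θ₀ : Fin p → ℝ) (s : ℝ) (hs : 1 ≤ s)
    (j : Fin p) :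
    kappaLow X θ₀ s ≤ (∑ i, Wdiag X θ₀ i * (X i j) ^ 2) / XnormSq X := by
  unfold kappaLow
  refine csInf_le ⟨0, ?_⟩ ⟨Pi.single j 1, e_ne j, by rw [e_card]; simpa using hs, ?_⟩
  · rintro _ ⟨θ, -, -, rfl⟩
    have := XnormSq_nonneg X
    have h2 := fun i => (Wdiag_bds X θ₀ i).1
    apply div_nonneg
    · exact Finset.sum_nonneg fun i _ => mul_nonneg (h2 i) (sq_nonneg _)
    · positivity
  · simp_rw [e_sum, e_sq, mul_one]

lemma XnormSq_pos {n p : ℕ} [NeZero p] (X : Fin n → Fin p → ℝ) (θ₀ : Fin p → ℝ) (s : ℝ) (hs : 1 ≤ s)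
    (h : 0 < kappaLow X θ₀ s) : 0 < XnormSq X := by
  rcases (XnormSq_nonneg X).lt_or_eq with h0 | h0
  · exact h0
  · have := kappaLow_le_e X θ₀ s hs 0
    rw [← h0, div_zero] at this
    linarith

lemma kappa_one_le {n p : ℕ} (X : Fin n → Fin p → ℝ) (θ₀ : Fin p → ℝ) (s : ℝ)
    (h : 0 < kappaLow X θ₀ s) : 1 ≤ s := by
  by_contra hs
  have : kappaLow X θ₀ s = 0 := by
    unfold kappaLow
    convert Real.sInf_empty
    rw [Set.eq_empty_iff_forall_notMem]
    rintro _ ⟨θ, h1, h2, -⟩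
    have h3 : (suppCard θ : ℝ) < 1 := by linarith
    have h4 : suppCard θ = 0 := by
      have : suppCard θ < 1 := by exact_mod_cast h3
      omega
    apply h1
    unfold suppCard at h4
    rw [Finset.card_eq_zero] at h4
    ext j
    by_contra hj
    have : j ∈ Finset.univ.filter fun j => θ j ≠ 0 := by simpa using hj
    rw [h4] at this
    simp at this
  linarith

lemma kappaLow_le {n p : ℕ} [NeZero p] (X : Fin n → Fin p → ℝ) (θ₀ : Fin p → ℝ) (hX : 0 < XnormSq X)
    (s : ℝ) (hs : 1 ≤ s) : kappaLow X θ₀ s ≤ 1 / 4 := by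
  refine (kappaLow_le_e X θ₀ s hs 0).trans ?_
  rw [div_le_iff₀ hX]
  calc _ ≤ ∑ i, 1 / 4 * X i 0 ^ 2 := Finset.sum_le_sum fun i _ =>
        mul_le_mul_of_nonneg_right (Wdiag_bds X θ₀ i).2 (sq_nonneg _)
    _ = 1 / 4 * colNormSq X 0 := by rw [← Finset.mul_sum]; rfl
    _ ≤ _ := by linarith [colNormSq_le X 0]

lemma kappaBar_bdd {n p : ℕ} (X : Fin n → Fin p → ℝ) (hX : 0 < XnormSq X) (s : ℝ) :
    BddAbove {r : ℝ | ∃ θ : Fin p → ℝ, θ ≠ 0 ∧ (suppCard θ : ℝ) ≤ s ∧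
    r = (∑ i, (∑ j, X i j * θ j) ^ 2) / (XnormSq X * ∑ j, (θ j) ^ 2)} := by
  refine ⟨(∑ i, ∑ j, X i j ^ 2) / XnormSq X, ?_⟩
  rintro _ ⟨θ, h1, -, rfl⟩
  have hpos : 0 < ∑ j, θ j ^ 2 := by
    obtain ⟨j, hj⟩ := Function.ne_iff.1 h1
    exact Finset.sum_pos' (fun _ _ => sq_nonneg _) ⟨j, Finset.mem_univ _, by
      have : θ j ≠ 0 := hj
      positivity⟩
  rw [← div_div, div_right_comm]
  gcongr
  rw [div_le_iff₀ hpos, Finset.sum_mul]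
  exact Finset.sum_le_sum fun i _ => Finset.sum_mul_sq_le_sq_mul_sq _ _ _

lemma kappaBar_ge {n p : ℕ} [NeZero p] (X : Fin n → Fin p → ℝ) (hX : 0 < XnormSq X) (s : ℝ)
    (hs : 1 ≤ s) : 1 ≤ kappaBar X s := by
  obtain ⟨j, hj⟩ := exists_eq_ciSup_of_finite (f := fun j => colNormSq X j)
  refine le_csSup (kappaBar_bdd X hX s) ⟨Pi.single j 1, e_ne j, by rw [e_card]; simpa using hs, ?_⟩
  simp_rw [e_sum, e_sq, mul_one]
  change colNormSq X j = XnormSq X at hj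
  rw [← hj]
  rw [← hj] at hX
  exact (div_self hX.ne').symm

lemma kappaBar_bound {n p : ℕ} (X : Fin n → Fin p → ℝ) (hX : 0 < XnormSq X) (s : ℝ)
    (θ : Fin p → ℝ) (hθ : (suppCard θ : ℝ) ≤ s) :
    ∑ i, (∑ j, X i j * θ j) ^ 2 ≤ kappaBar X s * XnormSq X * ∑ j, θ j ^ 2 := by
  by_cases h : θ = 0
  · simp [h]
  · have hpos : 0 < ∑ j, θ j ^ 2 := by
      obtain ⟨j, hj⟩ := Function.ne_iff.1 h
      exact Finset.sum_pos' (fun _ _ => sq_nonneg _) ⟨j, Finset.mem_univ _, by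
        have : θ j ≠ 0 := hj
        positivity⟩
    have := le_csSup (kappaBar_bdd X hX s) ⟨θ, h, hθ, rfl⟩
    rw [div_le_iff₀ (by positivity), ← mul_assoc] at this
    exact this

/-- On the event `𝒜_n(t,L,M₁,M₂)`, any minimizer `Q*` of `Q ↦ KL(Q‖Π(·|Y))` over the
variational family `𝒬` satisfies `KL(Q*‖Π(·|Y)) ≤ ζ_n`. -/
theorem vb_kl_bound_on_event {n p : ℕ} (hp : 2 ≤ p)
    (X : Fin n → Fin p → ℝ) (θ₀ : Fin p → ℝ) (hs₀ : 1 ≤ suppCard θ₀)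
    (πp : ℕ → ℝ) (hπnonneg : ∀ s, 0 ≤ πp s)
    (hπsum : ∑ s ∈ Finset.range (p + 1), πp s = 1)
    (lam : ℝ) (hlam : 0 < lam)
    (t L M₁ M₂ : ℝ) (ht : 0 < t) (hL : 0 < L) (hM₁ : 0 < M₁) (hM₂ : L < M₂)
    (hpe : (4 * Real.exp 1) ^ (1 / (M₂ - L)) ≤ (p : ℝ) ^ (suppCard θ₀ : ℝ))
    (hκ1 : 0 < kappaLow X θ₀ 1)
    (hκL : 0 < kappaLow X θ₀ (L * (suppCard θ₀ : ℝ)))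
    (y : Fin n → ℝ) (hy : ∀ i, y i = 0 ∨ y i = 1)
    (hyA : y ∈ eventA1 X θ₀ t ∩ eventA2 X θ₀ πp lam L ∩ eventA3 X θ₀ πp lam M₁ M₂)
    (Qstar : Measure (Fin p → ℝ)) (hQmem : Qstar ∈ varFamily p)
    (hQmin : ∀ Q ∈ varFamily p,
      KLdiv Qstar (posterior X πp lam y) ≤ KLdiv Q (posterior X πp lam y)) :
    KLdiv Qstar (posterior X πp lam y)
      ≤ (suppCard θ₀ : ℝ) * Real.log p *
          (L + (9 / 4) * M₁ ^ 2 * kappaBar X (L * (suppCard θ₀ : ℝ))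
            + (lam * Real.sqrt L / (Xnorm X * Real.sqrt (Real.log p))) *
              (2 * M₁
                + t * Real.sqrt L /
                    (4 * kappaLow X θ₀ (L * (suppCard θ₀ : ℝ)) * Xnorm X
                      * Real.sqrt (Real.log p))
                + Real.sqrt L / Real.sqrt (kappaLow X θ₀ 1 * Real.log p)))
        + L * (suppCard θ₀ : ℝ)
            * Real.log (1 / (4 * kappaLow X θ₀ (L * (suppCard θ₀ : ℝ))))
        + Real.log (2 * Real.exp 1) := by
  have hpn : NeZero p := ⟨by omega⟩
  obtain ⟨⟨hA1, hA2⟩, hA3⟩ := hyA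
  have hp1 : (1 : ℝ) < p := by exact_mod_cast hp
  have hsR : (1 : ℝ) ≤ (suppCard θ₀ : ℝ) := by exact_mod_cast hs₀
  have hXn := XnormSq_pos X θ₀ 1 le_rfl hκ1
  have hK1 := kappa_one_le X θ₀ _ hκL
  have hkb := kappaBar_ge X hXn _ hK1
  have hkL := kappaLow_le X θ₀ hXn _ hK1
  have hk1 := kappaLow_le X θ₀ hXn 1 le_rfl
  have hkX := kappaBar_bound X hXn (L * (suppCard θ₀ : ℝ))
  have hXs : Xnorm X ^ 2 = XnormSq X := Real.sq_sqrt hXn.le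
  have hN : 0 < Xnorm X := Real.sqrt_pos.2 hXn
  have hlp : 0 < Real.log p := Real.log_pos hp1
  change (3 / 4 : ℝ≥0∞) ≤
    posterior X πp lam y {θ | (suppCard θ : ℝ) ≤ L * (suppCard θ₀ : ℝ)} at hA2
  set r := M₁ * Real.sqrt ((suppCard θ₀ : ℝ) * Real.log p) / Xnorm X with hr
  have hr0 : 0 ≤ r := by positivity
  set ε := Real.exp (-M₂ * (suppCard θ₀ : ℝ) * Real.log p) with hε
  have hA3' : posterior X πp lam y {θ | √(∑ j, (θ j - θ₀ j) ^ 2) ≤ r}ᶜ ≤ ENNReal.ofReal ε := by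
    refine le_trans (measure_mono ?_) hA3
    intro θ hθ
    have h' : ¬ (√(∑ j, (θ j - θ₀ j) ^ 2) ≤ r) := hθ
    exact not_le.1 h'
  have hεlt : ε < 1 / 4 := by
    have hML : 0 < M₂ - L := by linarith
    have h1 := Real.log_le_log (by positivity) hpe
    rw [Real.log_rpow (by positivity), Real.log_rpow (by positivity),
      Real.log_mul (by norm_num) (by positivity), Real.log_exp, one_div, inv_mul_le_iff₀ hML] at h1
    have h2 : -M₂ * (suppCard θ₀ : ℝ) * Real.log p < Real.log (1 / 4) := by
      rw [one_div, Real.log_inv]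
      have : 0 ≤ L * ((suppCard θ₀ : ℝ) * Real.log p) := by positivity
      nlinarith
    calc ε < Real.exp (Real.log (1 / 4)) := Real.exp_lt_exp.2 h2
      _ = 1 / 4 := Real.exp_log (by norm_num)
  obtain ⟨S, hSK, hS⟩ := select (by omega) X πp lam y _ ε hεlt _ hA2 hA3'
  have hpost0 : posterior X πp lam y ≠ 0 := by
    intro h
    rw [h] at hA2
    simp at hA2
  have hZ0 : ∫⁻ θ, ENNReal.ofReal (Real.exp (loglik X y θ)) ∂(priorMeasure p πp lam) ≠ 0 := by
    intro h
    apply hpost0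
    unfold _root_.posterior
    have : (priorMeasure p πp lam).withDensity (fun θ => ENNReal.ofReal (Real.exp (loglik X y θ))) = 0 := by
      rw [← Measure.measure_univ_eq_zero, withDensity_apply _ MeasurableSet.univ]
      simpa using h
    rw [this, smul_zero]
  have hZt : ∫⁻ θ, ENNReal.ofReal (Real.exp (loglik X y θ)) ∂(priorMeasure p πp lam) ≠ ∞ := by
    intro h
    apply hpost0
    unfold _root_.posterior
    rw [h]
    simp
  have hfin : IsFiniteMeasure (posterior X πp lam y) := by
    constructor
    unfold _root_.posterior
    rw [Measure.smul_apply, withDensity_apply _ MeasurableSet.univ, Measure.restrict_univ, smul_eq_mul,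
      ENNReal.inv_mul_cancel hZ0 hZt]
    simp
  have hle : compS X πp lam y S ≤ posterior X πp lam y := by
    rw [posterior_eq]
    exact Finset.single_le_sum (f := fun S => compS X πp lam y S) (fun S _ => Measure.zero_le _) (Finset.mem_univ S)
  have hpK : 1 ≤ (p : ℝ) ^ (L * (suppCard θ₀ : ℝ)) := Real.one_le_rpow hp1.le (by positivity)
  have he1 : 1 ≤ Real.exp 1 := Real.one_le_exp (by norm_num)
  obtain ⟨Q, hQm, hQ⟩ := lemB X θ₀ πp lam hlam y S r (kappaBar X (L * (suppCard θ₀ : ℝ)) * XnormSq X)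
    (1 / (2 * Real.exp 1 * (p : ℝ) ^ (L * (suppCard θ₀ : ℝ)))) hr0 (by positivity) (by positivity)
    (by
      rw [div_le_one (by positivity)]
      nlinarith)
    (by
      intro θ hθ
      have hcard : (suppCard θ : ℝ) ≤ L * (suppCard θ₀ : ℝ) := by
        refine le_trans ?_ hSK
        unfold suppCard
        norm_cast
        refine Finset.card_le_card fun j hj => ?_
        by_contra h
        exact (Finset.mem_filter.1 hj).2 (hθ j h)
      exact hkX θ hcard)
    hfin hZ0 hZt hle hS
  refine (hQmin Q hQm).trans (hQ.trans ?_)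
  generalize kappaBar X (L * (suppCard θ₀ : ℝ)) = kb at *
  generalize kappaLow X θ₀ (L * (suppCard θ₀ : ℝ)) = kL at *
  generalize kappaLow X θ₀ 1 = k1 at *
  exact final_arith (suppCard θ₀ : ℝ) p L M₁ lam t (Xnorm X) (XnormSq X) kb kL k1 S.card r (by linarith) hp1
    hL hM₁ hlam ht hN hXs hkb hκL hkL hκ1 hk1 hSK (Nat.cast_nonneg _) hr
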